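/- For every finite tree T, mz(T) = mr^cr_ℤ(T), and this common value equals mr(T), mr_ℤ(T), γ(T) = γ_ℝ(T), and γ_ℤ(T). -/

import Mathlib

open scoped Classical

variable {V : Type*}

/-- The generalized Laplacian matrix `L(G, X_G)` of a simple graph `G`, with entries in the
polynomial ring `R[X_G]`: the `(u,v)` entry is the indeterminate `x_u` if `u = v`,
`-1` if `u` and `v` are adjacent, and `0` otherwise. -/
noncomputable def genLaplacian (R : Type*) [CommRing R] (G : SimpleGraph V) :
    Matrix V V (MvPolynomial V R) := fun u v =>
  if u = v then MvPolynomial.X u else if G.Adj u v then -1 else 0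

/-- The ideal generated by the determinants of all `i × i` submatrices of a square matrix. -/
noncomputable def minorsIdeal {S : Type*} [CommRing S] (M : Matrix V V S) (i : ℕ) : Ideal S :=
  Ideal.span { d : S | ∃ f g : Fin i → V, Function.Injective f ∧ Function.Injective g ∧
    d = (M.submatrix f g).det }

/-- The `i`-th critical ideal `I_i(G, X_G) ⊆ R[X_G]` of a simple graph `G`. -/
noncomputable def criticalIdeal (R : Type*) [CommRing R] (G : SimpleGraph V) (i : ℕ) :
    Ideal (MvPolynomial V R) :=
  minorsIdeal (genLaplacian R G) i

/-- The algebraic co-rank `γ_R(G)`: the largest `i` (with `0 ≤ i ≤ |V(G)|`) such that the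
`i`-th critical ideal of `G` over `R` is trivial (i.e. the whole ring). -/
noncomputable def algCoRank (R : Type*) [CommRing R] [Fintype V] (G : SimpleGraph V) : ℕ :=
  sSup {i | i ≤ Fintype.card V ∧ criticalIdeal R G i = ⊤}

/-- The rank of a square matrix over a commutative ring: the largest `k` such that some
`k × k` minor is nonzero and is not a zero divisor. -/
noncomputable def ringRank {R : Type*} [CommRing R] (M : Matrix V V R) : ℕ :=
  sSup {k | ∃ f g : Fin k → V, Function.Injective f ∧ Function.Injective g ∧
    (M.submatrix f g).det ≠ 0 ∧ (M.submatrix f g).det ∈ nonZeroDivisors R}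

/-- `A ∈ S_R(G)`: `A` is a symmetric matrix over `R`, indexed by the vertices of `G`, whose
off-diagonal `(u,v)` entry is nonzero iff `u` and `v` are adjacent (the diagonal is free). -/
def IsGraphMatrix {R : Type*} [CommRing R] (G : SimpleGraph V) (A : Matrix V V R) : Prop :=
  A.IsSymm ∧ ∀ u v : V, u ≠ v → (A u v ≠ 0 ↔ G.Adj u v)

/-- The minimum rank `mr_R(G)`: the smallest rank among matrices in `S_R(G)`. -/
noncomputable def minRank (R : Type*) [CommRing R] (G : SimpleGraph V) : ℕ :=
  sInf {k | ∃ A : Matrix V V R, IsGraphMatrix G A ∧ ringRank A = k}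

/-- The generalized Laplacian of `G` evaluated at a vector `d`: `L(G, d)` has `d u` on the
diagonal, `-1` at adjacent off-diagonal pairs and `0` elsewhere. -/
noncomputable def evalLaplacian {R : Type*} [CommRing R] (G : SimpleGraph V) (d : V → R) :
    Matrix V V R := fun u v =>
  if u = v then d u else if G.Adj u v then -1 else 0

/-- The critical minimum rank `mr^cr_R(G)`: the minimum of `rank (L(G,d))` over `d ∈ R^{V(G)}`. -/
noncomputable def crMinRank (R : Type*) [CommRing R] (G : SimpleGraph V) : ℕ :=
  sInf {k | ∃ d : V → R, ringRank (evalLaplacian G d) = k}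

/-- `a, b : Fin k → V` form a chronological list of forces for the zero forcing game on `G`
started with the vertices of `B` blue: at step `t` the force `a t → b t` is performed, which
requires that `a t` is blue, that `b t` is a white neighbor of `a t`, and that every white
neighbor of `a t` equals `b t`. -/
def IsChronList (G : SimpleGraph V) (B : Set V) {k : ℕ} (a b : Fin k → V) : Prop :=
  (∀ t, G.Adj (a t) (b t)) ∧
  (∀ t, a t ∈ B ∨ ∃ s, s < t ∧ b s = a t) ∧
  (∀ t, b t ∉ B ∧ ∀ s, s < t → b s ≠ b t) ∧
  (∀ t z, G.Adj (a t) z → z ∉ B → (∀ s, s < t → b s ≠ z) → z = b t)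

/-- `B` is a zero forcing set of `G`: starting with exactly `B` blue, there is a sequence of
forces turning every vertex of `G` blue. -/
def IsZeroForcingSet (G : SimpleGraph V) (B : Set V) : Prop :=
  ∃ (k : ℕ) (a b : Fin k → V), IsChronList G B a b ∧ ∀ v : V, v ∈ B ∨ ∃ t, b t = v

/-- The zero forcing number `Z(G)`: the minimum cardinality of a zero forcing set of `G`. -/
noncomputable def zeroForcingNumber [Fintype V] (G : SimpleGraph V) : ℕ :=
  sInf {m | ∃ B : Finset V, B.card = m ∧ IsZeroForcingSet G ↑B}

/-- `mz(G) = |V(G)| - Z(G)`. -/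
noncomputable def mz [Fintype V] (G : SimpleGraph V) : ℕ :=
  Fintype.card V - zeroForcingNumber G


/-! ### Zero forcing as an inductive closure; vertices of `F` are not allowed to force. -/

inductive Blue (G : SimpleGraph V) (F B : Set V) : V → Prop
  | base (v : V) : v ∈ B → Blue G F B v
  | force (x y : V) : x ∉ F → Blue G F B x → G.Adj x y →
      (∀ z, G.Adj x z → z ≠ y → Blue G F B z) → Blue G F B y

/-- `G` is obtained from `G'` by joining the disjoint closed parts `S₁ ∋ r` and `S₂ ∋ w` by the
edge `r w`. -/
structure IsJoin (G G' : SimpleGraph V) (S₁ S₂ : Set V) (r w : V) : Prop where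
  adj : ∀ x y, G.Adj x y ↔ G'.Adj x y ∨ (x = r ∧ y = w) ∨ (x = w ∧ y = r)
  disj : Disjoint S₁ S₂
  c₁ : ∀ x y, G'.Adj x y → x ∈ S₁ → y ∈ S₁
  c₂ : ∀ x y, G'.Adj x y → x ∈ S₂ → y ∈ S₂
  hr : r ∈ S₁
  hw : w ∈ S₂

theorem IsJoin.symm {G G' : SimpleGraph V} {S₁ S₂ : Set V} {r w : V}
    (h : IsJoin G G' S₁ S₂ r w) : IsJoin G G' S₂ S₁ w r :=
  ⟨fun x y => by rw [h.adj]; tauto, h.disj.symm, h.c₂, h.c₁, h.hw, h.hr⟩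

theorem Blue.mono {G : SimpleGraph V} {F F' B B' : Set V} (hF : F' ⊆ F) (hB : B ⊆ B') {v : V}
    (h : Blue G F B v) : Blue G F' B' v := by
  induction h with
  | base v hv => exact .base v (hB hv)
  | force x y hx _ hxy _ ih1 ih2 => exact .force x y (fun h => hx (hF h)) ih1 hxy ih2

theorem Blue.transfer {G G' : SimpleGraph V} {S₁ S₂ : Set V} {r w : V}
    (J : IsJoin G G' S₁ S₂ r w) {F F' B B' : Set V}
    (hF : ∀ x ∈ S₁, x ∈ F' → x ∈ F) (hB : ∀ x ∈ B, Blue G F' B' x)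
    (hrw : r ∈ F ∨ Blue G F' B' w) {v : V}
    (h : Blue G' F B v) : v ∈ S₁ → Blue G F' B' v := by
  induction h with
  | base v hv => exact fun _ => hB v hv
  | force x y hx _ hxy _ ih1 ih2 =>
    intro hy
    have hxS : x ∈ S₁ := J.c₁ y x hxy.symm hy
    refine .force x y (fun h => hx (hF x hxS h)) (ih1 hxS) ((J.adj x y).2 (Or.inl hxy)) ?_
    intro z hz hzy
    rcases (J.adj x z).1 hz with h | ⟨h1, h2⟩ | ⟨h1, h2⟩
    · exact ih2 z h hzy (J.c₁ x z h hxS)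
    · subst h1 h2
      exact hrw.resolve_left hx
    · subst h1
      exact absurd J.hw (Set.disjoint_left.1 J.disj hxS)

theorem Blue.self_aux {G : SimpleGraph V} {B : Set V} (r : V) {v : V}
    (h : Blue G ∅ B v) : Blue G {r} B v ∨ Blue G {r} B r := by
  induction h with
  | base v hv => exact Or.inl (.base v hv)
  | force x y hx _ hxy _ ih1 ih2 =>
    by_cases hr : Blue G {r} B r
    · exact Or.inr hr
    · left
      refine .force x y ?_ (ih1.resolve_right hr) hxy
        (fun z hz hzy => (ih2 z hz hzy).resolve_right hr)
      rintro rfl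
      exact hr (ih1.resolve_right hr)

theorem Blue.self {G : SimpleGraph V} {F B : Set V} {r : V} (_hF : F ⊆ {r})
    (h : Blue G F B r) : Blue G {r} B r :=
  (or_self_iff.1 (Blue.self_aux r (h.mono (Set.empty_subset F) subset_rfl)))

theorem union_ZF {G G' : SimpleGraph V} {S₁ S₂ : Set V} {r w : V}
    (J : IsJoin G G' S₁ S₂ r w) {F B₁ B₂ : Set V} (hF : F ⊆ {r})
    (h₁ : ∀ v ∈ S₁, Blue G' F B₁ v) (h₂ : ∀ v ∈ S₂, Blue G' ∅ B₂ v) :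
    ∀ v ∈ S₁ ∪ S₂, Blue G F (B₁ ∪ B₂) v := by
  have hb1 : ∀ x ∈ B₁, Blue G F (B₁ ∪ B₂) x := fun x hx => .base x (Or.inl hx)
  have hb2 : ∀ x ∈ B₂, Blue G F (B₁ ∪ B₂) x := fun x hx => .base x (Or.inr hx)
  have hFS : ∀ x ∈ S₂, x ∉ F := by
    intro x hx hxF
    have : x = r := hF hxF
    subst this
    exact Set.disjoint_left.1 J.disj J.hr hx
  have hr : Blue G F (B₁ ∪ B₂) r :=
    Blue.transfer J (F := {r}) (fun x _ hx => hF hx) hb1 (Or.inl rfl)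
      (Blue.self hF (h₁ r J.hr)) J.hr
  have hw : Blue G F (B₁ ∪ B₂) w :=
    Blue.transfer J.symm (F := {w}) (fun x hx hxF => absurd hxF (hFS x hx)) hb2 (Or.inl rfl)
      (Blue.self (Set.empty_subset _) (h₂ w J.hw)) J.hw
  rintro v (hv | hv)
  · exact Blue.transfer J (fun x _ hx => hx) hb1 (Or.inr hw) (h₁ v hv) hv
  · exact Blue.transfer J.symm (fun x hx hxF => absurd hxF (hFS x hx)) hb2 (Or.inr hr)
      (h₂ v hv) hv

theorem merge_ZF {G G' : SimpleGraph V} {S₁ S₂ : Set V} {r w : V}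
    (J : IsJoin G G' S₁ S₂ r w) {F B₁ B₂ : Set V} (hF : F ⊆ {w})
    (h₁ : ∀ v ∈ S₁, Blue G' {r} B₁ v) (h₂ : ∀ v ∈ S₂, Blue G' F B₂ v) :
    ∀ v ∈ S₁ ∪ S₂, Blue G F (B₁ ∪ (B₂ \ {w})) v := by
  have hFS : ∀ x ∈ S₁, x ∉ F := by
    intro x hx hxF
    have : x = w := hF hxF
    subst this
    exact Set.disjoint_left.1 J.disj hx J.hw
  have hS1 : ∀ v ∈ S₁, Blue G F (B₁ ∪ (B₂ \ {w})) v := fun v hv =>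
    Blue.transfer J (F := {r}) (fun x hx hxF => absurd hxF (hFS x hx))
      (fun x hx => .base x (Or.inl hx)) (Or.inl rfl) (h₁ v hv) hv
  have hw : Blue G F (B₁ ∪ (B₂ \ {w})) w := by
    refine .force r w (hFS r J.hr) (hS1 r J.hr) ((J.adj r w).2 (by tauto)) ?_
    intro z hz hzw
    rcases (J.adj r z).1 hz with h | ⟨h1, h2⟩ | ⟨h1, h2⟩
    · exact hS1 z (J.c₁ r z h J.hr)
    · exact absurd h2 hzw
    · exact absurd J.hw (h1 ▸ Set.disjoint_left.1 J.disj J.hr)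
  rintro v (hv | hv)
  · exact hS1 v hv
  · refine Blue.transfer J.symm (fun x _ hx => hx) ?_ (Or.inr (hS1 r J.hr)) (h₂ v hv) hv
    intro x hx
    by_cases hxw : x = w
    · exact hxw ▸ hw
    · exact .base x (Or.inr ⟨hx, hxw⟩)

/-- There is a set of size at most `m` forcing all of `S`, `F` not forcing, containing `R`. -/
def ZFx (G : SimpleGraph V) (S F R : Set V) (m : ℕ) : Prop :=
  ∃ B : Finset V, R ⊆ ↑B ∧ B.card ≤ m ∧ ∀ v ∈ S, Blue G F ↑B v

theorem ZFx.mono {G : SimpleGraph V} {S F R F' R' : Set V} {m : ℕ} (h : ZFx G S F R m)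
    (hF : F' ⊆ F) (hR : R' ⊆ R) : ZFx G S F' R' m := by
  obtain ⟨B, h1, h2, h3⟩ := h
  exact ⟨B, hR.trans h1, h2, fun v hv => (h3 v hv).mono hF subset_rfl⟩

theorem ZFx.union {G G' : SimpleGraph V} {S₁ S₂ : Set V} {r w : V}
    (J : IsJoin G G' S₁ S₂ r w) {F R R₂ : Set V} (hF : F ⊆ {r}) {m₁ m₂ : ℕ}
    (h₁ : ZFx G' S₁ F R m₁) (h₂ : ZFx G' S₂ ∅ R₂ m₂) : ZFx G (S₁ ∪ S₂) F R (m₁ + m₂) := by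
  obtain ⟨B, h1, h2, h3⟩ := h₁
  obtain ⟨B', -, h2', h3'⟩ := h₂
  refine ⟨B ∪ B', ?_, (Finset.card_union_le _ _).trans (by omega), ?_⟩
  · rw [Finset.coe_union]; exact h1.trans Set.subset_union_left
  · rw [Finset.coe_union]; exact union_ZF J hF h3 h3'

theorem ZFx.merge {G G' : SimpleGraph V} {S₁ S₂ : Set V} {r w : V}
    (J : IsJoin G G' S₁ S₂ r w) {F R : Set V} (hF : F ⊆ {w}) {m₁ m₂ : ℕ}
    (h₁ : ZFx G' S₁ {r} R m₁) (h₂ : ZFx G' S₂ F {w} m₂) :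
    ZFx G (S₁ ∪ S₂) F R (m₁ + m₂ - 1) := by
  obtain ⟨B, h1, h2, h3⟩ := h₁
  obtain ⟨B', h1', h2', h3'⟩ := h₂
  have hw : w ∈ B' := by simpa using h1'
  refine ⟨B ∪ B'.erase w, ?_, (Finset.card_union_le _ _).trans ?_, ?_⟩
  · rw [Finset.coe_union]; exact h1.trans Set.subset_union_left
  · rw [Finset.card_erase_of_mem hw]
    have := Finset.card_pos.2 ⟨w, hw⟩
    omega
  · rw [Finset.coe_union, Finset.coe_erase]; exact merge_ZF J hF h3 h3'

/-! ### Kernels -/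

/-- Row `v` of the generalized Laplacian applied to `x`. -/
noncomputable def rowL [Fintype V] (G : SimpleGraph V) (d : V → ℤ) (v : V) :
    (V → ℝ) →ₗ[ℝ] ℝ :=
  (d v : ℝ) • LinearMap.proj v - ∑ u : V, (if G.Adj v u then (1 : ℝ) else 0) • LinearMap.proj u

theorem rowL_apply [Fintype V] (G : SimpleGraph V) (d : V → ℤ) (v : V) (x : V → ℝ) :
    rowL G d v x = (d v : ℝ) * x v - ∑ u : V, (if G.Adj v u then (1 : ℝ) else 0) * x u := by
  simp only [rowL, LinearMap.sub_apply, LinearMap.smul_apply, LinearMap.sum_apply,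
    LinearMap.proj_apply, smul_eq_mul]

def KK [Fintype V] (G : SimpleGraph V) (S : Set V) (d : V → ℤ) : Submodule ℝ (V → ℝ) where
  carrier := {x | (∀ v, v ∉ S → x v = 0) ∧ ∀ v, rowL G d v x = 0}
  add_mem' := by
    rintro x y ⟨h1, h2⟩ ⟨h3, h4⟩
    exact ⟨fun v hv => by simp [h1 v hv, h3 v hv], fun v => by simp [h2, h4]⟩
  zero_mem' := by simp
  smul_mem' := by
    rintro c x ⟨h1, h2⟩
    exact ⟨fun v hv => by simp [h1 v hv], fun v => by simp [h2]⟩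

def NN [Fintype V] (G : SimpleGraph V) (S : Set V) (r : V) (d : V → ℤ) :
    Submodule ℝ (V → ℝ) where
  carrier := {x | (∀ v, v ∉ S → x v = 0) ∧ x r = 0 ∧ ∀ v, v ≠ r → rowL G d v x = 0}
  add_mem' := by
    rintro x y ⟨h1, h5, h2⟩ ⟨h3, h6, h4⟩
    exact ⟨fun v hv => by simp [h1 v hv, h3 v hv], by simp [h5, h6],
      fun v hv => by simp [h2 v hv, h4 v hv]⟩
  zero_mem' := by simp
  smul_mem' := by
    rintro c x ⟨h1, h5, h2⟩
    exact ⟨fun v hv => by simp [h1 v hv], by simp [h5], fun v hv => by simp [h2 v hv]⟩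

theorem finrank_inf_ker [Fintype V] (A : Submodule ℝ (V → ℝ)) (φ : (V → ℝ) →ₗ[ℝ] ℝ) :
    Module.finrank ℝ A ≤ Module.finrank ℝ ↥(A ⊓ LinearMap.ker φ) + 1 := by
  have h1 := LinearMap.finrank_range_add_finrank_ker (φ.domRestrict A)
  have h2 : Module.finrank ℝ (LinearMap.range (φ.domRestrict A)) ≤ 1 := by
    simpa using Submodule.finrank_le (LinearMap.range (φ.domRestrict A))
  have h3 : Module.finrank ℝ (LinearMap.ker (φ.domRestrict A))
      = Module.finrank ℝ ↥(A ⊓ LinearMap.ker φ) := by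
    rw [LinearMap.ker_domRestrict]
    rw [← Submodule.finrank_map_subtype_eq A]
    rw [Submodule.map_comap_subtype]
  omega

theorem finrank_sup_supp [Fintype V] {A B : Submodule ℝ (V → ℝ)} {S₁ S₂ : Set V}
    (hd : Disjoint S₁ S₂) (hA : ∀ x ∈ A, ∀ v, v ∉ S₁ → x v = 0)
    (hB : ∀ x ∈ B, ∀ v, v ∉ S₂ → x v = 0) :
    Module.finrank ℝ ↥(A ⊔ B) = Module.finrank ℝ A + Module.finrank ℝ B := by
  have h := Submodule.finrank_sup_add_finrank_inf_eq A B
  have h0 : A ⊓ B = ⊥ := by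
    rw [eq_bot_iff]
    rintro x ⟨hx1, hx2⟩
    rw [Submodule.mem_bot]
    ext v
    by_cases hv : v ∈ S₁
    · exact hB x hx2 v (Set.disjoint_left.1 hd hv)
    · exact hA x hx1 v hv
  rw [h0, finrank_bot] at h
  omega

theorem rowL_congr [Fintype V] (G : SimpleGraph V) {d d' : V → ℤ} {S : Set V}
    (h : ∀ v ∈ S, d v = d' v) {x : V → ℝ} (hx : ∀ v, v ∉ S → x v = 0) (v : V) :
    rowL G d v x = rowL G d' v x := by
  rw [rowL_apply, rowL_apply]
  by_cases hv : v ∈ S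
  · rw [h v hv]
  · rw [hx v hv]; simp

theorem KK_congr [Fintype V] (G : SimpleGraph V) {d d' : V → ℤ} {S : Set V}
    (h : ∀ v ∈ S, d v = d' v) : KK G S d = KK G S d' := by
  ext x
  constructor
  · rintro ⟨h1, h2⟩
    exact ⟨h1, fun v => by rw [← rowL_congr G h h1]; exact h2 v⟩
  · rintro ⟨h1, h2⟩
    exact ⟨h1, fun v => by rw [rowL_congr G h h1]; exact h2 v⟩

theorem NN_congr [Fintype V] (G : SimpleGraph V) {d d' : V → ℤ} {S : Set V} {r : V}
    (h : ∀ v ∈ S, d v = d' v) : NN G S r d = NN G S r d' := by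
  ext x
  constructor
  · rintro ⟨h1, h3, h2⟩
    exact ⟨h1, h3, fun v hv => by rw [← rowL_congr G h h1]; exact h2 v hv⟩
  · rintro ⟨h1, h3, h2⟩
    exact ⟨h1, h3, fun v hv => by rw [rowL_congr G h h1]; exact h2 v hv⟩

def KKx [Fintype V] (G : SimpleGraph V) (S : Set V) (m : ℕ) : Prop :=
  ∃ d : V → ℤ, m ≤ Module.finrank ℝ (KK G S d)

def NNx [Fintype V] (G : SimpleGraph V) (S : Set V) (r : V) (m : ℕ) : Prop :=
  ∃ d : V → ℤ, m ≤ Module.finrank ℝ (NN G S r d)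

theorem NNx.toKK [Fintype V] {G : SimpleGraph V} {S : Set V} {r : V} {m : ℕ}
    (h : NNx G S r (m + 1)) : KKx G S m := by
  obtain ⟨d, hd⟩ := h
  refine ⟨d, ?_⟩
  have h1 := finrank_inf_ker (NN G S r d) (rowL G d r)
  have h2 : NN G S r d ⊓ LinearMap.ker (rowL G d r) ≤ KK G S d := by
    rintro x ⟨⟨h1, h2, h3⟩, h4⟩
    refine ⟨h1, fun v => ?_⟩
    by_cases hv : v = r
    · subst hv; exact h4
    · exact h3 v hv
  have := Submodule.finrank_mono h2
  omega

theorem KKx.toNN [Fintype V] {G : SimpleGraph V} {S : Set V} {r : V} {m : ℕ}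
    (h : KKx G S m) : NNx G S r (m - 1) := by
  obtain ⟨d, hd⟩ := h
  refine ⟨d, ?_⟩
  have h1 := finrank_inf_ker (KK G S d) (LinearMap.proj r)
  have h2 : KK G S d ⊓ LinearMap.ker (LinearMap.proj r) ≤ NN G S r d := by
    rintro x ⟨⟨h1, h3⟩, h4⟩
    exact ⟨h1, h4, fun v _ => h3 v⟩
  have := Submodule.finrank_mono h2
  omega

theorem rowL_join [Fintype V] {G G' : SimpleGraph V} {S₁ S₂ : Set V} {r w : V}
    (J : IsJoin G G' S₁ S₂ r w) (d : V → ℤ) (v : V) (x : V → ℝ) :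
    rowL G d v x = rowL G' d v x - (if v = r then x w else 0) - (if v = w then x r else 0) := by
  have hrw : r ≠ w := fun h => Set.disjoint_left.1 J.disj J.hr (h ▸ J.hw)
  have hn : ¬ G'.Adj r w := fun h => Set.disjoint_left.1 J.disj (J.c₁ r w h J.hr) J.hw
  have hn' : ¬ G'.Adj w r := fun h => hn h.symm
  rw [rowL_apply, rowL_apply]
  have h : ∀ u, (if G.Adj v u then (1 : ℝ) else 0) * x u =
      (if G'.Adj v u then (1 : ℝ) else 0) * x u + (if u = w then (if v = r then x w else 0) else 0)
        + (if u = r then (if v = w then x r else 0) else 0) := by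
    intro u
    by_cases h1 : v = r
    · subst h1
      by_cases h2 : u = w
      · subst h2
        simp [J.adj, hn, hrw, hrw.symm]
      · simp [J.adj, h2, hrw]
    · by_cases h3 : v = w
      · subst h3
        by_cases h2 : u = r
        · subst h2
          simp [J.adj, hn', h1]
        · simp [J.adj, h2, h1]
      · simp [J.adj, h1, h3]
  rw [Finset.sum_congr rfl (fun u _ => h u), Finset.sum_add_distrib, Finset.sum_add_distrib,
    Finset.sum_ite_eq' Finset.univ w, Finset.sum_ite_eq' Finset.univ r]
  simp only [Finset.mem_univ, if_true]
  ring

/-- Glue two diagonals. -/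
noncomputable def glue (S₁ : Set V) (d₁ d₂ : V → ℤ) (v : V) : ℤ := if v ∈ S₁ then d₁ v else d₂ v

theorem glue₁ (S₁ : Set V) (d₁ d₂ : V → ℤ) : ∀ v ∈ S₁, d₁ v = glue S₁ d₁ d₂ v := by
  intro v hv; simp [glue, hv]

theorem glue₂ {S₁ S₂ : Set V} (h : Disjoint S₁ S₂) (d₁ d₂ : V → ℤ) :
    ∀ v ∈ S₂, d₂ v = glue S₁ d₁ d₂ v := by
  intro v hv; simp [glue, Set.disjoint_right.1 h hv]

theorem join_NK [Fintype V] {G G' : SimpleGraph V} {S₁ S₂ : Set V} {r w : V}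
    (J : IsJoin G G' S₁ S₂ r w) {n k : ℕ} (h₁ : NNx G' S₁ r n) (h₂ : KKx G' S₂ k) :
    NNx G (S₁ ∪ S₂) r (n + k) := by
  obtain ⟨d₁, h₁⟩ := h₁
  obtain ⟨d₂, h₂⟩ := h₂
  rw [NN_congr G' (glue₁ S₁ d₁ d₂)] at h₁
  rw [KK_congr G' (glue₂ J.disj d₁ d₂)] at h₂
  generalize glue S₁ d₁ d₂ = d at *
  refine ⟨d, ?_⟩
  have hs := finrank_sup_supp (A := NN G' S₁ r d) (B := KK G' S₂ d) J.disj
    (fun x hx => hx.1) (fun x hx => hx.1)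
  have hle : NN G' S₁ r d ⊔ KK G' S₂ d ≤ NN G (S₁ ∪ S₂) r d := by
    intro x hx
    obtain ⟨y, ⟨hy1, hy2, hy3⟩, z, ⟨hz1, hz2⟩, rfl⟩ := Submodule.mem_sup.1 hx
    have hzr : z r = 0 := hz1 r (Set.disjoint_left.1 J.disj J.hr)
    refine ⟨fun v hv => ?_, ?_, fun v hv => ?_⟩
    · rw [Set.mem_union, not_or] at hv
      simp [hy1 v hv.1, hz1 v hv.2]
    · simp [hy2, hzr]
    · rw [rowL_join J]
      simp [hy3 v hv, hz2 v, hv, hy2, hzr]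
  have := Submodule.finrank_mono hle
  omega

theorem join_KN [Fintype V] {G G' : SimpleGraph V} {S₁ S₂ : Set V} {r w : V}
    (J : IsJoin G G' S₁ S₂ r w) {n k : ℕ} (h₁ : KKx G' S₁ k) (h₂ : NNx G' S₂ w (n + 1)) :
    KKx G (S₁ ∪ S₂) (k + n) := by
  obtain ⟨d₁, h₁⟩ := h₁
  obtain ⟨d₂, h₂⟩ := h₂
  rw [KK_congr G' (glue₁ S₁ d₁ d₂)] at h₁
  rw [NN_congr G' (glue₂ J.disj d₁ d₂)] at h₂
  generalize glue S₁ d₁ d₂ = d at *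
  refine ⟨d, ?_⟩
  have hs := finrank_sup_supp (A := KK G' S₁ d) (B := NN G' S₂ w d) J.disj
    (fun x hx => hx.1) (fun x hx => hx.1)
  have hk := finrank_inf_ker (KK G' S₁ d ⊔ NN G' S₂ w d) (rowL G' d w - LinearMap.proj r)
  have hle : (KK G' S₁ d ⊔ NN G' S₂ w d) ⊓ LinearMap.ker (rowL G' d w - LinearMap.proj r)
      ≤ KK G (S₁ ∪ S₂) d := by
    rintro x ⟨hx, hφ⟩
    obtain ⟨y, ⟨hy1, hy2⟩, z, ⟨hz1, hz3, hz2⟩, rfl⟩ := Submodule.mem_sup.1 hx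
    have hyw : y w = 0 := hy1 w (Set.disjoint_right.1 J.disj J.hw)
    refine ⟨fun v hv => ?_, fun v => ?_⟩
    · rw [Set.mem_union, not_or] at hv
      simp [hy1 v hv.1, hz1 v hv.2]
    · rw [rowL_join J]
      by_cases hv : v = w
      · subst hv
        have hφ' : rowL G' d v (y + z) - (y + z) r = 0 := hφ
        have hvr : v ≠ r := fun h => Set.disjoint_left.1 J.disj J.hr (h ▸ J.hw)
        simp only [hvr, if_true, if_false, sub_zero]
        exact hφ'
      · simp [hy2 v, hz2 v hv, hv, hyw, hz3]
  have := Submodule.finrank_mono hle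
  omega

theorem join_KK [Fintype V] {G G' : SimpleGraph V} {S₁ S₂ : Set V} {r w : V}
    (J : IsJoin G G' S₁ S₂ r w) {n k : ℕ} (h₁ : KKx G' S₁ k) (h₂ : KKx G' S₂ n) :
    KKx G (S₁ ∪ S₂) (k + n - 1) := by
  obtain ⟨d₁, h₁⟩ := h₁
  obtain ⟨d₂, h₂⟩ := h₂
  rw [KK_congr G' (glue₁ S₁ d₁ d₂)] at h₁
  rw [KK_congr G' (glue₂ J.disj d₁ d₂)] at h₂
  generalize glue S₁ d₁ d₂ = d at *
  let d' : V → ℤ := fun v => d v + (if v = r then 1 else 0) + (if v = w then 1 else 0)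
  have hrow : ∀ v x, rowL G' d' v x
      = rowL G' d v x + (if v = r then x r else 0) + (if v = w then x w else 0) := by
    intro v x
    rw [rowL_apply, rowL_apply]
    simp only [d']
    have e1 : (if v = r then x r else 0) = (if v = r then (1 : ℝ) else 0) * x v := by
      split_ifs with h
      · rw [h, one_mul]
      · simp
    have e2 : (if v = w then x w else 0) = (if v = w then (1 : ℝ) else 0) * x v := by
      split_ifs with h
      · rw [h, one_mul]
      · simp
    rw [e1, e2]
    push_cast
    ring
  refine ⟨d', ?_⟩
  have hs := finrank_sup_supp (A := KK G' S₁ d) (B := KK G' S₂ d) J.disj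
    (fun x hx => hx.1) (fun x hx => hx.1)
  let φ : (V → ℝ) →ₗ[ℝ] ℝ :=
    LinearMap.proj (R := ℝ) (φ := fun _ : V => ℝ) w - LinearMap.proj (R := ℝ) (φ := fun _ : V => ℝ) r
  have hk := finrank_inf_ker (KK G' S₁ d ⊔ KK G' S₂ d) φ
  have hle : (KK G' S₁ d ⊔ KK G' S₂ d) ⊓ LinearMap.ker φ
      ≤ KK G (S₁ ∪ S₂) d' := by
    rintro x ⟨hx, hφ⟩
    obtain ⟨y, ⟨hy1, hy2⟩, z, ⟨hz1, hz2⟩, rfl⟩ := Submodule.mem_sup.1 hx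
    have hφ' : (y + z) w - (y + z) r = 0 := hφ
    have hφ2 : (y + z) w = (y + z) r := sub_eq_zero.1 hφ'
    refine ⟨fun v hv => ?_, fun v => ?_⟩
    · rw [Set.mem_union, not_or] at hv
      simp [hy1 v hv.1, hz1 v hv.2]
    · rw [rowL_join J, hrow, hφ2, map_add, hy2 v, hz2 v]
      ring
  have := Submodule.finrank_mono hle
  omega

/-! ### The three states of a rooted tree -/

def St0 [Fintype V] (G : SimpleGraph V) (S : Set V) (r : V) (m : ℕ) : Prop :=
  ZFx G S {r} {r} m ∧ KKx G S m

def St1 [Fintype V] (G : SimpleGraph V) (S : Set V) (r : V) (m : ℕ) : Prop :=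
  ZFx G S ∅ {r} m ∧ ZFx G S {r} ∅ m ∧ KKx G S m ∧ NNx G S r m

def St2 [Fintype V] (G : SimpleGraph V) (S : Set V) (r : V) (m : ℕ) : Prop :=
  ZFx G S ∅ ∅ m ∧ NNx G S r (m + 1)

def St [Fintype V] (G : SimpleGraph V) (S : Set V) (r : V) : Prop :=
  ∃ m, St0 G S r m ∨ St1 G S r m ∨ St2 G S r m

theorem St.join [Fintype V] {G G' : SimpleGraph V} {S₁ S₂ : Set V} {r w : V}
    (J : IsJoin G G' S₁ S₂ r w) (h₁ : St G' S₁ r) (h₂ : St G' S₂ w) : St G (S₁ ∪ S₂) r := by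
  obtain ⟨m₁, h₁⟩ := h₁
  obtain ⟨m₂, h₂⟩ := h₂
  have he : ∀ {s : Set V}, ∅ ⊆ s := fun {s} => Set.empty_subset s
  -- either `w` is open or closed
  have h₂' : (ZFx G' S₂ ∅ {w} m₂ ∧ ZFx G' S₂ {w} ∅ m₂ ∧ KKx G' S₂ m₂) ∨ St2 G' S₂ w m₂ := by
    rcases h₂ with ⟨a, b⟩ | ⟨a, b, c, -⟩ | h
    · exact Or.inl ⟨a.mono he subset_rfl, a.mono subset_rfl he, b⟩
    · exact Or.inl ⟨a, b, c⟩
    · exact Or.inr h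
  rcases h₂' with ⟨a, b, c⟩ | ⟨a, c⟩
  · rcases h₁ with ⟨a', b'⟩ | ⟨a', b', c', e'⟩ | ⟨a', c'⟩
    · refine ⟨m₁ + m₂ - 1, Or.inr (Or.inl ⟨a'.merge J he a, ?_, join_KK J b' c, ?_⟩)⟩
      · have := b.merge J.symm subset_rfl a'
        rwa [Set.union_comm, Nat.add_comm m₂] at this
      · have hm : 1 ≤ m₁ := by
          obtain ⟨B, h1, h2, -⟩ := a'
          have := Finset.card_pos.2 ⟨r, by simpa using h1⟩
          omega
        have := join_NK J (b'.toNN (r := r)) c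
        rwa [show m₁ - 1 + m₂ = m₁ + m₂ - 1 by omega] at this
    · refine ⟨m₁ + m₂ - 1, Or.inr (Or.inr ⟨b'.merge J he a, ?_⟩)⟩
      have hm : 1 ≤ m₂ := by
        obtain ⟨B, h1, h2, -⟩ := a
        have := Finset.card_pos.2 ⟨w, by simpa using h1⟩
        omega
      have := join_NK J e' c
      rwa [show m₁ + m₂ - 1 + 1 = m₁ + m₂ by omega]
    · refine ⟨m₁ + m₂, Or.inr (Or.inr ⟨a'.union J he a, ?_⟩)⟩
      have := join_NK J c' c
      rwa [show m₁ + 1 + m₂ = m₁ + m₂ + 1 by omega] at this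
  · refine ⟨m₁ + m₂, ?_⟩
    rcases h₁ with ⟨a', b'⟩ | ⟨a', b', c', e'⟩ | ⟨a', c'⟩
    · exact Or.inl ⟨a'.union J subset_rfl a, join_KN J b' c⟩
    · exact Or.inr (Or.inl ⟨a'.union J he a, b'.union J subset_rfl a, join_KN J c' c,
        join_NK J e' c.toKK⟩)
    · refine Or.inr (Or.inr ⟨a'.union J he a, ?_⟩)
      have := join_NK J c' c.toKK
      rwa [show m₁ + 1 + m₂ = m₁ + m₂ + 1 by omega] at this

theorem St.single [Fintype V] (G : SimpleGraph V) (r : V) (h : ∀ v, ¬ G.Adj r v) :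
    St G {r} r := by
  refine ⟨1, Or.inl ⟨⟨{r}, by simp, by simp, ?_⟩, ⟨0, ?_⟩⟩⟩
  · rintro v rfl
    exact .base _ (by simp)
  · have hm : Pi.single r (1 : ℝ) ∈ KK G {r} 0 := by
      refine ⟨fun v hv => by simp [Pi.single_apply]; simpa using hv, fun v => ?_⟩
      rw [rowL_apply]
      have : ¬ G.Adj v r := fun h' => h v h'.symm
      simp [Pi.single_apply, this]
    have hle : Submodule.span ℝ {(Pi.single r (1 : ℝ) : V → ℝ)} ≤ KK G {r} 0 := by
      rw [Submodule.span_singleton_le_iff_mem]; exact hm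
    have h2 := Submodule.finrank_mono hle
    rwa [finrank_span_singleton (by simp)] at h2

theorem St.of_acyclic [Fintype V] : ∀ (n : ℕ) (G : SimpleGraph V), G.IsAcyclic →
    G.edgeSet.ncard = n → ∀ r, St G {v | G.Reachable r v} r := by
  intro n
  induction n using Nat.strong_induction_on with
  | _ n ih =>
  intro G hG hn r
  by_cases hr : ∃ w, G.Adj r w
  · obtain ⟨w, hw⟩ := hr
    let G' := G.deleteEdges {s(r, w)}
    have hle : G' ≤ G := SimpleGraph.deleteEdges_le _
    have hG' : G'.IsAcyclic := hG.anti hle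
    have hnr : ¬ G'.Reachable r w := by
      have := SimpleGraph.isAcyclic_iff_forall_adj_isBridge.1 hG hw
      rw [SimpleGraph.isBridge_iff] at this
      exact this
    have hlt : G'.edgeSet.ncard < n := by
      rw [← hn]
      apply Set.ncard_lt_ncard _ (Set.toFinite _)
      rw [SimpleGraph.edgeSet_ssubset_edgeSet]
      refine lt_of_le_of_ne hle ?_
      intro h
      exact hnr (SimpleGraph.Adj.reachable (h ▸ hw : G'.Adj r w))
    have hadj : ∀ x y, G.Adj x y ↔ G'.Adj x y ∨ (x = r ∧ y = w) ∨ (x = w ∧ y = r) := by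
      intro x y
      simp only [G', SimpleGraph.deleteEdges_adj, Set.mem_singleton_iff, Sym2.eq_iff]
      constructor
      · intro h; tauto
      · rintro (h | ⟨rfl, rfl⟩ | ⟨rfl, rfl⟩)
        · exact h.1
        · exact hw
        · exact hw.symm
    have J : IsJoin G G' {v | G'.Reachable r v} {v | G'.Reachable w v} r w :=
      { adj := hadj
        disj := Set.disjoint_left.2 fun v h1 h2 =>
          hnr (SimpleGraph.Reachable.trans h1 (SimpleGraph.Reachable.symm h2))
        c₁ := fun x y h hx => SimpleGraph.Reachable.trans hx h.reachable
        c₂ := fun x y h hx => SimpleGraph.Reachable.trans hx h.reachable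
        hr := SimpleGraph.Reachable.refl _
        hw := SimpleGraph.Reachable.refl _ }
    have hS : {v | G.Reachable r v} = {v | G'.Reachable r v} ∪ {v | G'.Reachable w v} := by
      ext v
      constructor
      · rintro ⟨p⟩
        have key : ∀ (x y : V) (p : G.Walk x y),
            x ∈ {v | G'.Reachable r v} ∪ {v | G'.Reachable w v} →
            y ∈ {v | G'.Reachable r v} ∪ {v | G'.Reachable w v} := by
          intro x y p
          induction p with
          | nil => exact id
          | cons h p ih' =>
            intro hx
            apply ih'
            rcases (hadj _ _).1 h with h | ⟨-, rfl⟩ | ⟨-, rfl⟩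
            · rcases hx with hx | hx
              · exact Or.inl (J.c₁ _ _ h hx)
              · exact Or.inr (J.c₂ _ _ h hx)
            · exact Or.inr J.hw
            · exact Or.inl J.hr
        exact key r v p (Or.inl J.hr)
      · rintro (h | h)
        · exact SimpleGraph.Reachable.mono hle h
        · exact hw.reachable.trans (SimpleGraph.Reachable.mono hle h)
    rw [hS]
    exact St.join J (ih _ hlt G' hG' rfl r) (ih _ hlt G' hG' rfl w)
  · push Not at hr
    have : {v | G.Reachable r v} = {r} := by
      ext v
      constructor
      · rintro ⟨p⟩
        cases p with
        | nil => rfl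
        | cons h p => exact absurd h (hr _)
      · rintro rfl
        exact SimpleGraph.Reachable.refl _
    rw [this]
    exact St.single G r hr

theorem tree_key [Fintype V] (T : SimpleGraph V) (hconn : T.Connected) (hacyc : T.IsAcyclic) :
    ∃ (m : ℕ) (B : Finset V) (d : V → ℤ), B.card ≤ m ∧ (∀ v, Blue T ∅ ↑B v) ∧
      m ≤ Module.finrank ℝ (KK T Set.univ d) := by
  obtain ⟨r⟩ := hconn.nonempty
  have h := St.of_acyclic _ T hacyc rfl r
  have hu : {v | T.Reachable r v} = Set.univ := by
    ext v; simpa using hconn.preconnected r v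
  rw [hu] at h
  obtain ⟨m, h⟩ := h
  have : ZFx T Set.univ ∅ ∅ m ∧ KKx T Set.univ m := by
    rcases h with ⟨a, b⟩ | ⟨a, b, c, -⟩ | ⟨a, b⟩
    · exact ⟨a.mono (Set.empty_subset _) (Set.empty_subset _), b⟩
    · exact ⟨a.mono (Set.empty_subset _) (Set.empty_subset _), c⟩
    · exact ⟨a, b.toKK⟩
  obtain ⟨⟨B, -, h1, h2⟩, d, hd⟩ := this
  exact ⟨m, B, d, h1, fun v => h2 v trivial, hd⟩

/-! ### From the closure to chronological lists -/

theorem IsChronList.inj {G : SimpleGraph V} {B : Set V} {k : ℕ} {a b : Fin k → V}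
    (h : IsChronList G B a b) : Function.Injective b := by
  intro s t hst
  rcases lt_trichotomy s t with h1 | h1 | h1
  · exact absurd hst ((h.2.2.1 t).2 s h1)
  · exact h1
  · exact absurd hst.symm ((h.2.2.1 s).2 t h1)

theorem exists_extension {G : SimpleGraph V} {B : Set V} {k : ℕ} {a b : Fin k → V}
    (h : IsChronList G B a b) (hB : ∀ v, Blue G ∅ B v)
    (hne : ¬ ∀ v, v ∈ B ∨ ∃ t, b t = v) :
    ∃ a' b' : Fin (k + 1) → V, IsChronList G B a' b' := by
  have key : ∃ x y, (x ∈ B ∨ ∃ t, b t = x) ∧ G.Adj x y ∧ ¬ (y ∈ B ∨ ∃ t, b t = y) ∧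
      ∀ z, G.Adj x z → z ≠ y → (z ∈ B ∨ ∃ t, b t = z) := by
    by_contra hcon
    push Not at hcon
    apply hne
    intro v
    induction hB v with
    | base v hv => exact Or.inl hv
    | force x y _ _ hxy _ ih1 ih2 =>
      by_contra hy
      rw [not_or] at hy
      push Not at hy
      obtain ⟨z, hz, hzy, hz1, hz2⟩ := hcon x y ih1 hxy hy
      rcases ih2 z hz hzy with h | ⟨t, ht⟩
      · exact hz1 h
      · exact hz2 t ht
  obtain ⟨x, y, hx, hxy, hy, hz⟩ := key
  rw [not_or] at hy
  push Not at hy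
  obtain ⟨h1, h2, h3, h4⟩ := h
  have hlt : ∀ (t : Fin k) (s : Fin (k + 1)), s < t.castSucc → ∃ s' : Fin k, s = s'.castSucc ∧ s' < t := by
    intro t s hs
    have h' : s.val < t.val := hs
    exact ⟨⟨s.val, h'.trans t.2⟩, rfl, h'⟩
  refine ⟨Fin.snoc (α := fun _ => V) a x, Fin.snoc (α := fun _ => V) b y, ?_, ?_, ?_, ?_⟩
  · intro t
    refine Fin.lastCases ?_ (fun t => ?_) t
    · simpa using hxy
    · simpa using h1 t
  · intro t
    refine Fin.lastCases ?_ (fun t => ?_) t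
    · rcases hx with hx | ⟨s, hs⟩
      · left; simpa using hx
      · right; exact ⟨s.castSucc, Fin.castSucc_lt_last s, by simpa using hs⟩
    · rcases h2 t with hx | ⟨s, hs, hs'⟩
      · left; simpa using hx
      · right; exact ⟨s.castSucc, by simpa using hs, by simpa using hs'⟩
  · intro t
    refine Fin.lastCases ?_ (fun t => ?_) t
    · refine ⟨by simpa using hy.1, fun s hs => ?_⟩
      have hs' : s.val < k := hs
      have : s = (⟨s.val, hs'⟩ : Fin k).castSucc := rfl
      rw [this, Fin.snoc_castSucc, Fin.snoc_last]
      exact hy.2 ⟨s.val, hs'⟩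
    · refine ⟨by simpa using (h3 t).1, fun s hs => ?_⟩
      obtain ⟨s', rfl, hs'⟩ := hlt t s hs
      simpa using (h3 t).2 s' hs'
  · intro t
    refine Fin.lastCases ?_ (fun t => ?_) t
    · intro z hz1 hzB hzb
      simp only [Fin.snoc_last] at hz1 ⊢
      by_contra hne'
      rcases hz z hz1 hne' with h | ⟨s, hs⟩
      · exact hzB h
      · exact hzb s.castSucc (Fin.castSucc_lt_last s) (by simpa using hs)
    · intro z hz1 hzB hzb
      simp only [Fin.snoc_castSucc] at hz1 ⊢
      refine h4 t z hz1 hzB fun s hs => ?_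
      simpa using hzb s.castSucc (by simpa using hs)

theorem isZeroForcingSet_of_blue [Fintype V] {G : SimpleGraph V} {B : Set V}
    (hB : ∀ v, Blue G ∅ B v) : IsZeroForcingSet G B := by
  by_contra hcon
  have : ∀ k : ℕ, ∃ a b : Fin k → V, IsChronList G B a b := by
    intro k
    induction k with
    | zero => exact ⟨Fin.elim0, Fin.elim0, fun t => t.elim0, fun t => t.elim0, fun t => t.elim0,
        fun t => t.elim0⟩
    | succ k ih =>
      obtain ⟨a, b, h⟩ := ih
      exact exists_extension h hB fun h' => hcon ⟨k, a, b, h, h'⟩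
  obtain ⟨a, b, h⟩ := this (Fintype.card V + 1)
  have := Fintype.card_le_of_injective b h.inj
  simp at this

/-! ### Lower bounds -/

theorem chron_a_inj {G : SimpleGraph V} {B : Set V} {k : ℕ} {a b : Fin k → V}
    (h : IsChronList G B a b) : Function.Injective a := by
  have key : ∀ s t : Fin k, s < t → a s ≠ a t := by
    intro s t hst hab
    have h1 : G.Adj (a s) (b t) := hab ▸ h.1 t
    have := h.2.2.2 s (b t) h1 (h.2.2.1 t).1 fun u hu => (h.2.2.1 t).2 u (hu.trans hst)
    exact (h.2.2.1 t).2 s hst this.symm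
  intro s t hst
  rcases lt_trichotomy s t with h1 | h1 | h1
  · exact absurd hst (key s t h1)
  · exact h1
  · exact absurd hst.symm (key t s h1)

theorem chron_det {R : Type*} [CommRing R] {G : SimpleGraph V} {B : Set V} {k : ℕ}
    {a b : Fin k → V} (h : IsChronList G B a b) (A : Matrix V V R)
    (hA : ∀ u v, u ≠ v → ¬ G.Adj u v → A u v = 0) :
    (A.submatrix a b).det = ∏ t, A (a t) (b t) := by
  rw [Matrix.det_of_isLowerTriangular]
  · rfl
  · intro i j hij
    have hij' : i < j := hij
    rw [Matrix.submatrix_apply]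
    apply hA
    · intro he
      rcases h.2.1 i with hb | ⟨s, hs, hs'⟩
      · exact (h.2.2.1 j).1 (he ▸ hb)
      · exact (h.2.2.1 j).2 s (hs.trans hij') (hs'.trans he)
    · intro hadj
      have := h.2.2.2 i (b j) hadj (h.2.2.1 j).1 fun u hu => (h.2.2.1 j).2 u (hu.trans hij')
      exact (h.2.2.1 j).2 i hij' this.symm

theorem exists_chron_mz [Fintype V] (G : SimpleGraph V) :
    ∃ (B : Set V) (a b : Fin (mz G) → V), IsChronList G B a b := by
  have hne : {m | ∃ B : Finset V, B.card = m ∧ IsZeroForcingSet G ↑B}.Nonempty :=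
    ⟨_, Finset.univ, rfl, isZeroForcingSet_of_blue fun v => .base v (by simp)⟩
  obtain ⟨B, hB, k, a, b, h, hall⟩ := Nat.sInf_mem hne
  have hk : k = mz G := by
    unfold mz zeroForcingNumber
    rw [← hB, ← Finset.card_compl]
    have : Bᶜ = Finset.univ.image b := by
      ext v
      simp only [Finset.mem_compl, Finset.mem_image, Finset.mem_univ, true_and]
      constructor
      · intro hv
        rcases hall v with h' | h'
        · exact absurd (by simpa using h') hv
        · exact h'
      · rintro ⟨t, rfl⟩
        simpa using (h.2.2.1 t).1
    rw [this, Finset.card_image_of_injective _ h.inj, Finset.card_univ, Fintype.card_fin]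
  subst hk
  exact ⟨_, a, b, h⟩

theorem le_ringRank [Fintype V] {R : Type*} [CommRing R] (M : Matrix V V R) {k : ℕ}
    (f g : Fin k → V) (hf : Function.Injective f) (hg : Function.Injective g)
    (h : (M.submatrix f g).det ≠ 0) (h' : (M.submatrix f g).det ∈ nonZeroDivisors R) :
    k ≤ ringRank M := by
  apply le_csSup
  · refine ⟨Fintype.card V, ?_⟩
    rintro k ⟨f, g, hf, -⟩
    simpa using Fintype.card_le_of_injective f hf
  · exact ⟨f, g, hf, hg, h, h'⟩

theorem mz_le_ringRank [Fintype V] {R : Type*} [CommRing R] [IsDomain R] (G : SimpleGraph V)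
    (A : Matrix V V R) (hA : IsGraphMatrix G A) : mz G ≤ ringRank A := by
  obtain ⟨B, a, b, h⟩ := exists_chron_mz G
  have hd := chron_det h A fun u v huv hn => by
    by_contra h0
    exact hn ((hA.2 u v huv).1 h0)
  have h0 : (A.submatrix a b).det ≠ 0 := by
    rw [hd, Finset.prod_ne_zero_iff]
    intro t _
    exact (hA.2 _ _ (h.1 t).ne).2 (h.1 t)
  exact le_ringRank A a b (chron_a_inj h) h.inj h0 (mem_nonZeroDivisors_of_ne_zero h0)

theorem criticalIdeal_mz [Fintype V] (R : Type*) [CommRing R] (G : SimpleGraph V) :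
    criticalIdeal R G (mz G) = ⊤ := by
  obtain ⟨B, a, b, h⟩ := exists_chron_mz G
  have hd := chron_det h (genLaplacian R G) fun u v huv hn => by simp [genLaplacian, huv, hn]
  apply Ideal.eq_top_of_isUnit_mem (x := ((genLaplacian R G).submatrix a b).det)
  · exact Ideal.subset_span ⟨a, b, chron_a_inj h, h.inj, rfl⟩
  · rw [hd]
    have : ∀ t, genLaplacian R G (a t) (b t) = -1 := fun t => by
      simp [genLaplacian, (h.1 t).ne, h.1 t]
    simp only [this]
    rw [Finset.prod_const]
    exact (isUnit_one.neg).pow _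

theorem evalLaplacian_isGraphMatrix {R : Type*} [CommRing R] [Nontrivial R] (G : SimpleGraph V)
    (d : V → R) : IsGraphMatrix G (evalLaplacian G d) := by
  constructor
  · ext u v
    simp only [evalLaplacian, Matrix.transpose_apply]
    by_cases h : u = v
    · subst h; simp
    · simp [h, Ne.symm h, G.adj_comm]
  · intro u v huv
    simp [evalLaplacian, huv]

/-! ### Upper bounds -/

theorem rank_evalLaplacian [Fintype V] (G : SimpleGraph V) (d : V → ℤ) :
    (evalLaplacian G (fun v => (d v : ℝ))).rank + Module.finrank ℝ (KK G Set.univ d)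
      ≤ Fintype.card V := by
  have h := LinearMap.finrank_range_add_finrank_ker
    (evalLaplacian G (fun v => (d v : ℝ))).mulVecLin
  rw [Module.finrank_fintype_fun_eq_card] at h
  have hle : KK G Set.univ d ≤ LinearMap.ker (evalLaplacian G (fun v => (d v : ℝ))).mulVecLin := by
    rintro x ⟨-, hx⟩
    rw [LinearMap.mem_ker]
    ext v
    have := hx v
    rw [rowL_apply] at this
    rw [Matrix.mulVecLin_apply, Pi.zero_apply, ← this]
    simp only [Matrix.mulVec, dotProduct]
    have e : ∀ u, evalLaplacian G (fun v => (d v : ℝ)) v u * x u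
        = (if u = v then (d v : ℝ) * x v else 0) - (if G.Adj v u then (1 : ℝ) else 0) * x u := by
      intro u
      by_cases h : u = v
      · subst h; simp [evalLaplacian]
      · by_cases h' : G.Adj v u <;> simp [evalLaplacian, h, Ne.symm h, h']
    rw [Finset.sum_congr rfl fun u _ => e u, Finset.sum_sub_distrib]
    simp
  have := Submodule.finrank_mono hle
  rw [Matrix.rank]
  omega

theorem minor_zero [Fintype V] (M : Matrix V V ℝ) {k : ℕ} (f g : Fin k → V)
    (h : (M.submatrix f g).det ≠ 0) : k ≤ M.rank := by
  have h1 : (M.submatrix f g).rank = k := by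
    rw [Matrix.rank_of_isUnit _ ((Matrix.isUnit_iff_isUnit_det _).2 h.isUnit), Fintype.card_fin]
  rw [← h1]
  exact Matrix.rank_submatrix_le M f g

theorem cast_evalLaplacian (G : SimpleGraph V) (d : V → ℤ) :
    (evalLaplacian G d).map (Int.castRingHom ℝ) = evalLaplacian G (fun v => (d v : ℝ)) := by
  ext u v
  simp only [evalLaplacian, Matrix.map_apply]
  split_ifs <;> simp

theorem ringRank_real_le [Fintype V] (M : Matrix V V ℝ) : ringRank M ≤ M.rank := by
  apply csSup_le'
  rintro k ⟨f, g, -, -, h, -⟩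
  exact minor_zero M f g h

theorem det_cast {k : ℕ} (M : Matrix V V ℤ) (f g : Fin k → V) :
    (((M.submatrix f g).det : ℤ) : ℝ) = ((M.map (Int.castRingHom ℝ)).submatrix f g).det := by
  rw [Matrix.submatrix_map]
  exact RingHom.map_det (Int.castRingHom ℝ) (M.submatrix f g)

theorem ringRank_int_le [Fintype V] (M : Matrix V V ℤ) :
    ringRank M ≤ (M.map (Int.castRingHom ℝ)).rank := by
  apply csSup_le'
  rintro k ⟨f, g, -, -, h, -⟩
  apply minor_zero _ f g
  rw [← det_cast]
  exact_mod_cast h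

theorem eval_genLaplacian {R : Type*} [CommRing R] (G : SimpleGraph V) (d : V → R) :
    (genLaplacian R G).map (MvPolynomial.eval d) = evalLaplacian G d := by
  ext u v
  simp only [evalLaplacian, genLaplacian, Matrix.map_apply]
  split_ifs <;> simp

theorem exists_minor {R : Type*} [CommRing R] [Nontrivial R] (G : SimpleGraph V) (d : V → R)
    {i : ℕ} (h : criticalIdeal R G i = ⊤) :
    ∃ f g : Fin i → V, ((evalLaplacian G d).submatrix f g).det ≠ 0 := by
  by_contra hcon
  push Not at hcon
  have hle : criticalIdeal R G i ≤ RingHom.ker (MvPolynomial.eval d) := by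
    unfold criticalIdeal minorsIdeal
    rw [Ideal.span_le]
    rintro _ ⟨f, g, -, -, rfl⟩
    rw [SetLike.mem_coe, RingHom.mem_ker, RingHom.map_det, ← hcon f g, ← eval_genLaplacian]
    rfl
  rw [h] at hle
  have : (1 : MvPolynomial V R) ∈ RingHom.ker (MvPolynomial.eval d) := hle trivial
  rw [RingHom.mem_ker, map_one] at this
  exact one_ne_zero this

theorem algCoRank_eq [Fintype V] {R : Type*} [CommRing R] (G : SimpleGraph V)
    (h : ∀ i, criticalIdeal R G i = ⊤ → i ≤ mz G) : mz G = algCoRank R G := by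
  apply le_antisymm
  · apply le_csSup
    · exact ⟨Fintype.card V, fun i hi => hi.1⟩
    · exact ⟨Nat.sub_le _ _, criticalIdeal_mz R G⟩
  · apply csSup_le'
    rintro i ⟨-, hi⟩
    exact h i hi

/-- For every finite tree `T`, `mz(T) = mr^cr_ℤ(T)`, and this common value
equals `mr(T) = mr_ℝ(T)`, `mr_ℤ(T)`, `γ(T) = γ_ℝ(T)`, and `γ_ℤ(T)`. -/
theorem tree_mz_eq_crMinRank {V : Type*} [Fintype V] (T : SimpleGraph V)
    (hconn : T.Connected) (hacyc : T.IsAcyclic) :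
    mz T = crMinRank ℤ T ∧ mz T = minRank ℝ T ∧ mz T = minRank ℤ T ∧
      mz T = algCoRank ℝ T ∧ mz T = algCoRank ℤ T := by
  obtain ⟨m, B, d, hBm, hB, hd⟩ := tree_key T hconn hacyc
  have hZ : zeroForcingNumber T ≤ B.card :=
    Nat.sInf_le ⟨B, rfl, isZeroForcingSet_of_blue hB⟩
  have hrank : (evalLaplacian T (fun v => (d v : ℝ))).rank ≤ mz T := by
    have := rank_evalLaplacian T d
    unfold mz
    omega
  have hrankInt : ringRank (evalLaplacian T d) ≤ mz T := by
    refine (ringRank_int_le _).trans ?_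
    rw [cast_evalLaplacian]
    exact hrank
  have hreal := (ringRank_real_le (evalLaplacian T (fun v => (d v : ℝ)))).trans hrank
  refine ⟨?_, ?_, ?_, ?_, ?_⟩
  · apply le_antisymm
    · refine le_csInf ⟨_, d, rfl⟩ ?_
      rintro _ ⟨d', rfl⟩
      exact mz_le_ringRank T _ (evalLaplacian_isGraphMatrix T d')
    · exact le_trans (Nat.sInf_le ⟨d, rfl⟩) hrankInt
  · apply le_antisymm
    · refine le_csInf ⟨_, _, evalLaplacian_isGraphMatrix T (fun v => (d v : ℝ)), rfl⟩ ?_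
      rintro _ ⟨A, hA, rfl⟩
      exact mz_le_ringRank T _ hA
    · exact le_trans (Nat.sInf_le ⟨_, evalLaplacian_isGraphMatrix T _, rfl⟩) hreal
  · apply le_antisymm
    · refine le_csInf ⟨_, _, evalLaplacian_isGraphMatrix T d, rfl⟩ ?_
      rintro _ ⟨A, hA, rfl⟩
      exact mz_le_ringRank T _ hA
    · exact le_trans (Nat.sInf_le ⟨_, evalLaplacian_isGraphMatrix T d, rfl⟩) hrankInt
  · apply algCoRank_eq
    intro i hi
    obtain ⟨f, g, h⟩ := exists_minor T (fun v => (d v : ℝ)) hi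
    exact (minor_zero _ f g h).trans hrank
  · apply algCoRank_eq
    intro i hi
    obtain ⟨f, g, h⟩ := exists_minor T d hi
    refine le_trans (minor_zero _ f g ?_) hrank
    rw [← cast_evalLaplacian, ← det_cast]
    exact_mod_cast h
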